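/- arXiv:2506.13547 — 7 statements merged into one kernel-verified Lean document; each statement's English description precedes it below -/
import Mathlib

section
/- Let m ≥ 2 and let K ≠ Δ_{[m]} be a simplicial complex on [m]. Then the cones C(I,J), taken over all faces (I,J) of Bier(K), cover ℝ^{m−1}: for every x ∈ ℝ^{m−1} there exist disjoint sets I, J ⊆ [m] with I ∈ K and [m]∖J ∉ K such that x ∈ C(I,J). (Completeness of the canonical fan Σ_K.) -/
open Finset

/-- The vectors `e_1, ..., e_m` in `ℝ^{m-1}`: for `i` with `(i : ℕ) < m - 1` this is the
standard basis vector, and the last one is `e_m = -(e_1 + ⋯ + e_{m-1})`,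
i.e. the all-(-1) vector. -/
noncomputable def bierVec (m : ℕ) (i : Fin m) : Fin (m - 1) → ℝ :=
  if h : (i : ℕ) < m - 1 then Pi.single ⟨i, h⟩ 1 else fun _ => -1

/-- The cone `C(I, J)`: all nonnegative combinations of the `-e_i`, `i ∈ I`,
and the `e_j`, `j ∈ J`. -/
def coneC (m : ℕ) (I J : Finset (Fin m)) : Set (Fin (m - 1) → ℝ) :=
  {x | ∃ a b : Fin m → ℝ, (∀ i, 0 ≤ a i) ∧ (∀ j, 0 ≤ b j) ∧
    x = ∑ i ∈ I, a i • (-(bierVec m i)) + ∑ j ∈ J, b j • bierVec m j}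

/-- `K` is a simplicial complex on `[m]` (with ghost vertices allowed):
a nonempty collection of subsets of `[m]` closed under passing to subsets. -/
def IsSimplicialComplex (m : ℕ) (K : Finset (Finset (Fin m))) : Prop :=
  K.Nonempty ∧ ∀ s ∈ K, ∀ t ⊆ s, t ∈ K

/-- `(I, J)` is a face of the Bier sphere `Bier(K)`: `I` and `J` are disjoint,
`I ∈ K` and `J ∈ K^∨`, i.e. `[m] \ J ∉ K`. -/
def IsBierFace (m : ℕ) (K : Finset (Finset (Fin m))) (I J : Finset (Fin m)) : Prop :=
  Disjoint I J ∧ I ∈ K ∧ Finset.univ \ J ∉ K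

/-- The vectors `e_1, ..., e_m` sum to zero. -/
lemma sum_bierVec (m : ℕ) (hm : 1 ≤ m) : ∑ i, bierVec m i = 0 := by
  obtain ⟨n, rfl⟩ : ∃ n, m = n + 1 := ⟨m - 1, by omega⟩
  funext k
  change Fin n at k
  simp [Fin.sum_univ_castSucc, bierVec, Finset.sum_apply, Pi.single_apply, Fin.ext_iff]
  simp [← Fin.ext_iff, Finset.filter_eq]

/-- The vectors `e_1, ..., e_m` span `ℝ^{m-1}`. -/
lemma exists_eq_sum_smul_bierVec (m : ℕ) (x : Fin (m - 1) → ℝ) (hm : 1 ≤ m) :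
    ∃ y : Fin m → ℝ, x = ∑ i, y i • bierVec m i := by
  obtain ⟨n, rfl⟩ : ∃ n, m = n + 1 := ⟨m - 1, by omega⟩
  refine ⟨Fin.snoc (α := fun _ => ℝ) (x : Fin n → ℝ) 0, ?_⟩
  funext k
  change Fin n at k
  simp [Fin.sum_univ_castSucc, bierVec, Finset.sum_apply, Pi.single_apply, Fin.ext_iff]
  simp [← Fin.ext_iff]

/-- Cutting a coefficient vector at any level `c` puts the point in the cone of the
indices strictly below and strictly above `c`. -/
lemma sum_smul_bierVec_mem_coneC (m : ℕ) (hm : 1 ≤ m) (y : Fin m → ℝ) (c : ℝ) :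
    ∑ i, y i • bierVec m i ∈
      coneC m (univ.filter fun i => y i < c) (univ.filter fun i => c < y i) := by
  refine ⟨fun i => max (c - y i) 0, fun i => max (y i - c) 0, fun _ => le_max_right _ _,
    fun _ => le_max_right _ _, ?_⟩
  have h : ∑ i, y i • bierVec m i = ∑ i, (y i - c) • bierVec m i := by
    simp [sub_smul, Finset.sum_sub_distrib, ← Finset.smul_sum, sum_bierVec m hm]
  rw [h, Finset.sum_filter, Finset.sum_filter, ← Finset.sum_add_distrib]
  refine Finset.sum_congr rfl fun i _ => ?_
  beta_reduce
  rcases lt_trichotomy (y i) c with hlt | heq | hgt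
  · rw [if_pos hlt, if_neg hlt.not_gt, max_eq_left (by linarith)]
    module
  · simp [heq]
  · rw [if_neg hgt.not_gt, if_pos hgt, max_eq_left (by linarith), zero_add]

/-- Some level `c` of `y` cuts `[m]` into a face of `Bier(K)`. -/
lemma exists_isBierFace_filter (m : ℕ) (K : Finset (Finset (Fin m)))
    (hK : IsSimplicialComplex m K) (hm : 1 ≤ m) (huniv : univ ∉ K) (y : Fin m → ℝ) :
    ∃ c : ℝ, IsBierFace m K (univ.filter fun i => y i < c) (univ.filter fun i => c < y i) := by
  have : Nonempty (Fin m) := ⟨⟨0, hm⟩⟩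
  have hne : (univ.filter fun i => (univ.filter fun j => y j ≤ y i) ∉ K).Nonempty := by
    obtain ⟨i, -, hi⟩ := exists_max_image univ y univ_nonempty
    refine ⟨i, mem_filter.2 ⟨mem_univ i, ?_⟩⟩
    rwa [filter_true_of_mem hi]
  obtain ⟨i, hi, hmin⟩ := exists_min_image _ y hne
  refine ⟨y i, ?_, ?_, ?_⟩
  · exact disjoint_filter.2 fun j _ h => h.not_gt
  · rcases (univ.filter fun j => y j < y i).eq_empty_or_nonempty with he | hI
    · obtain ⟨s, hs⟩ := hK.1
      rw [he]
      exact hK.2 s hs _ (empty_subset s)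
    · obtain ⟨k, hk, hmax⟩ := exists_max_image _ y hI
      have hkK : (univ.filter fun j => y j ≤ y k) ∈ K := by
        by_contra hcon
        exact (hmin k (mem_filter.2 ⟨mem_univ k, hcon⟩)).not_gt (mem_filter.1 hk).2
      exact hK.2 _ hkK _ fun j hj => mem_filter.2 ⟨mem_univ j, hmax j hj⟩
  · have hcompl : univ \ (univ.filter fun j => y i < y j) = univ.filter fun j => y j ≤ y i := by
      ext j
      simp
    rw [hcompl]
    exact (mem_filter.1 hi).2

/-- Completeness of the canonical fan `Σ_K`: the cones `C(I, J)`, over all faces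
`(I, J)` of `Bier(K)`, cover `ℝ^{m-1}`. -/
theorem bier_fan_complete (m : ℕ) (hm : 2 ≤ m) (K : Finset (Finset (Fin m)))
    (hK : IsSimplicialComplex m K) (hKne : K ≠ (Finset.univ : Finset (Fin m)).powerset) :
    ∀ x : Fin (m - 1) → ℝ, ∃ I J : Finset (Fin m),
      IsBierFace m K I J ∧ x ∈ coneC m I J := by
  intro x
  have huniv : univ ∉ K := fun h => hKne <| by
    ext s
    simpa using hK.2 _ h s (subset_univ s)
  obtain ⟨y, rfl⟩ := exists_eq_sum_smul_bierVec m x (by omega)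
  obtain ⟨c, hc⟩ := exists_isBierFace_filter m K hK (by omega) huniv y
  exact ⟨_, _, hc, sum_smul_bierVec_mem_coneC m (by omega) y c⟩
end

section
/- Let m ≥ 2 and let K ≠ Δ_{[m]} be a simplicial complex on [m]. Then for every x ∈ ℝ^{m−1} there exists exactly one face (I,J) of Bier(K) (i.e., exactly one pair of disjoint sets I, J ⊆ [m] with I ∈ K and [m]∖J ∉ K) such that x ∈ C°(I,J). (The relative interiors of the cones of the canonical fan Σ_K partition ℝ^{m−1}.) -/
open Finset

/-- The "interior" `C°(I, J)` of the cone `C(I, J)`: all combinations of the `-e_i`, `i ∈ I`,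
and the `e_j`, `j ∈ J`, with strictly positive coefficients (so `C°(∅, ∅) = {0}`). -/
def coneCInt (m : ℕ) (I J : Finset (Fin m)) : Set (Fin (m - 1) → ℝ) :=
  {x | ∃ a b : Fin m → ℝ, (∀ i ∈ I, 0 < a i) ∧ (∀ j ∈ J, 0 < b j) ∧
    x = ∑ i ∈ I, a i • (-(bierVec m i)) + ∑ j ∈ J, b j • bierVec m j}

/-- The coordinates of a linear combination of the vectors `e_1, ..., e_m`. -/
theorem sum_smul_bierVec_apply {n : ℕ} (c : Fin (n + 1) → ℝ) (k : Fin n) :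
    (∑ i, c i • bierVec (n + 1) i : Fin (n + 1 - 1) → ℝ) k = c k.castSucc - c (Fin.last n) := by
  have h_single (i : Fin n) :
      bierVec (n + 1) i.castSucc k = (Pi.single i 1 : Fin n → ℝ) k := by
    have hi : ((i.castSucc : Fin (n + 1)) : ℕ) < n + 1 - 1 := i.isLt
    unfold bierVec
    rw [dif_pos hi]
    rfl
  have h_last : bierVec (n + 1) (Fin.last n) k = -1 := by
    simp [bierVec]
  rw [Finset.sum_apply, Fin.sum_univ_castSucc]
  simp only [Pi.smul_apply, smul_eq_mul, h_single, h_last]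
  simp [Pi.single_apply, sub_eq_add_neg]

/-- For disjoint `I` and `J`, a point of the open cone is a linear combination of the `e_i` whose
coefficients are negative exactly on `I` and positive exactly on `J`. -/
theorem mem_coneCInt_iff_exists_sign {m : ℕ} {I J : Finset (Fin m)} (h : Disjoint I J)
    (x : Fin (m - 1) → ℝ) :
    x ∈ coneCInt m I J ↔ ∃ c : Fin m → ℝ, x = ∑ i, c i • bierVec m i ∧
      (∀ i, i ∈ I ↔ c i < 0) ∧ ∀ i, i ∈ J ↔ 0 < c i := by
  have h_notMem : ∀ i ∈ I, i ∉ J := fun i hi hj => Finset.disjoint_left.mp h hi hj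
  have h_sum (a b c : Fin m → ℝ)
      (hc : ∀ i, c i = if i ∈ I then -a i else if i ∈ J then b i else 0) :
      ∑ i ∈ I, a i • (-(bierVec m i)) + ∑ j ∈ J, b j • bierVec m j =
        ∑ i, c i • bierVec m i := by
    rw [← Finset.sum_ite_mem_eq I, ← Finset.sum_ite_mem_eq J, ← Finset.sum_add_distrib]
    refine Finset.sum_congr rfl fun i _ => ?_
    rw [hc i]
    by_cases hi : i ∈ I
    · simp [hi, h_notMem i hi]
    · by_cases hj : i ∈ J <;> simp [hi, hj]
  constructor
  · rintro ⟨a, b, ha, hb, rfl⟩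
    refine ⟨_, h_sum a b _ fun i => rfl, fun i => ?_, fun i => ?_⟩ <;> grind
  · rintro ⟨c, rfl, hI, hJ⟩
    refine ⟨fun i => -c i, c, fun i hi => neg_pos.mpr ((hI i).mp hi), fun i => (hJ i).mp,
      (h_sum _ _ _ fun i => ?_).symm⟩
    have h₁ := hI i
    have h₂ := hJ i
    grind

/-- The open cones are cut out by thresholds: with `e_m` given the coordinate `0`, a point lies in
the open cone of `(I, J)` iff for some `t` the set `I` consists of the coordinates below `t` and
`J` of those above `t`. -/
theorem mem_coneCInt_iff_exists_threshold {n : ℕ} {I J : Finset (Fin (n + 1))} (h : Disjoint I J)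
    (x : Fin n → ℝ) :
    x ∈ coneCInt (n + 1) I J ↔ ∃ t : ℝ,
      I = univ.filter (fun i => (Fin.snoc x 0 : Fin (n + 1) → ℝ) i < t) ∧
      J = univ.filter (fun i => t < (Fin.snoc x 0 : Fin (n + 1) → ℝ) i) := by
  rw [mem_coneCInt_iff_exists_sign h]
  constructor
  · rintro ⟨c, hx, hI, hJ⟩
    have hc (i : Fin (n + 1)) : (Fin.snoc x 0 : Fin (n + 1) → ℝ) i = c i - c (Fin.last n) := by
      refine Fin.lastCases ?_ (fun k => ?_) i
      · simp
      · rw [Fin.snoc_castSucc, ← sum_smul_bierVec_apply]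
        exact congrFun hx k
    refine ⟨-c (Fin.last n), ?_, ?_⟩ <;> ext i <;> simp only [mem_filter_univ, hc, hI, hJ] <;>
      constructor <;> intro _ <;> linarith
  · rintro ⟨t, rfl, rfl⟩
    refine ⟨fun i => (Fin.snoc x 0 : Fin (n + 1) → ℝ) i - t, ?_, by simp, by simp⟩
    funext k
    refine Eq.trans ?_ (sum_smul_bierVec_apply _ k).symm
    simp

/-- For a proper simplicial complex `K` and a real-valued function `y` on its vertices there is a
threshold `t` with `{y < t} ∈ K` and `{y ≤ t} ∉ K`. -/
theorem IsSimplicialComplex.exists_threshold {m : ℕ} {K : Finset (Finset (Fin m))}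
    (hK : IsSimplicialComplex m K) (h_univ : univ ∉ K) (y : Fin m → ℝ) :
    ∃ t : ℝ, univ.filter (fun i => y i < t) ∈ K ∧ univ.filter (fun i => y i ≤ t) ∉ K := by
  obtain ⟨s₀, hs₀⟩ := hK.1
  have h_empty : ∅ ∈ K := hK.2 s₀ hs₀ ∅ (Finset.empty_subset _)
  have h_ne : (univ : Finset (Fin m)).Nonempty :=
    Finset.nonempty_iff_ne_empty.mpr fun h => h_univ (h ▸ h_empty)
  obtain ⟨j, -, hj⟩ := Finset.exists_max_image univ y h_ne
  have h_bad : (univ.filter fun i => univ.filter (fun k => y k ≤ y i) ∉ K).Nonempty := by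
    refine ⟨j, (mem_filter_univ _).mpr ?_⟩
    rwa [Finset.filter_true_of_mem hj]
  obtain ⟨i, hi, h_min⟩ := Finset.exists_min_image _ y h_bad
  refine ⟨y i, ?_, (mem_filter_univ i).mp hi⟩
  rcases (univ.filter fun k => y k < y i).eq_empty_or_nonempty with h | h
  · rwa [h]
  · obtain ⟨l, hl, h_max⟩ := Finset.exists_max_image _ y h
    have hl' : y l < y i := (mem_filter_univ l).mp hl
    have h_mem : univ.filter (fun k => y k ≤ y l) ∈ K := by
      by_contra h_not
      exact absurd (h_min l ((mem_filter_univ _).mpr h_not)) hl'.not_ge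
    exact hK.2 _ h_mem _ fun k hk => (mem_filter_univ _).mpr (h_max k hk)

/-- The relative interiors of the cones of the canonical fan `Σ_K` partition `ℝ^{m-1}`:
every point lies in the interior of exactly one cone `C(I, J)`, `(I, J)` a face of
`Bier(K)`. -/
theorem bier_fan_interiors_partition (m : ℕ) (hm : 2 ≤ m) (K : Finset (Finset (Fin m)))
    (hK : IsSimplicialComplex m K) (hKne : K ≠ (Finset.univ : Finset (Fin m)).powerset) :
    ∀ x : Fin (m - 1) → ℝ, ∃! p : Finset (Fin m) × Finset (Fin m),
      IsBierFace m K p.1 p.2 ∧ x ∈ coneCInt m p.1 p.2 := by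
  have h_univ : univ ∉ K := fun h => hKne <| by
    ext s
    simpa using hK.2 _ h s (Finset.subset_univ s)
  obtain ⟨n, rfl⟩ : ∃ n, m = n + 1 := ⟨m - 1, by omega⟩
  intro x
  have h_sdiff (y : Fin (n + 1) → ℝ) (t : ℝ) :
      univ \ univ.filter (fun i => t < y i) = univ.filter (fun i => y i ≤ t) := by
    ext i
    simp
  obtain ⟨t, h_lt, h_le⟩ := hK.exists_threshold h_univ (Fin.snoc x 0 : Fin (n + 1) → ℝ)
  have h_disj : Disjoint (univ.filter fun i => (Fin.snoc x 0 : Fin (n + 1) → ℝ) i < t)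
      (univ.filter fun i => t < (Fin.snoc x 0 : Fin (n + 1) → ℝ) i) :=
    Finset.disjoint_filter.mpr fun i _ h => h.not_gt
  refine ⟨(_, _), ⟨⟨h_disj, h_lt, (h_sdiff _ t).symm ▸ h_le⟩,
    (mem_coneCInt_iff_exists_threshold h_disj x).mpr ⟨t, rfl, rfl⟩⟩, ?_⟩
  rintro ⟨I, J⟩ ⟨⟨h_IJ, hI, hJ⟩, hx⟩
  obtain ⟨s, rfl, rfl⟩ := (mem_coneCInt_iff_exists_threshold h_IJ x).mp hx
  dsimp only at hI hJ
  rw [h_sdiff] at hJ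
  have h_step {y : Fin (n + 1) → ℝ} {u v : ℝ} (huv : u < v)
      (hv : univ.filter (fun i => y i < v) ∈ K) : univ.filter (fun i => y i ≤ u) ∈ K :=
    hK.2 _ hv _ fun i hi => (mem_filter_univ _).mpr (((mem_filter_univ _).mp hi).trans_lt huv)
  rcases lt_trichotomy s t with h | rfl | h
  · exact absurd (h_step h h_lt) hJ
  · rfl
  · exact absurd (h_step h hI) h_le
end

section
/- Let m ≥ 2 and let K ≠ Δ_{[m]} be a simplicial complex on [m]. Then Bier(K) is pure of dimension m − 2: every face (I,J) of Bier(K) satisfies |I| + |J| ≤ m − 1, and every face (I,J) is contained componentwise (I ⊆ I*, J ⊆ J*) in a face (I*,J*) of Bier(K) with |I*| + |J*| = m − 1. In particular, every maximal face of Bier(K) has exactly m − 1 elements. -/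
open Finset

theorem IsBierFace.card_add_card_le {m : ℕ} {K : Finset (Finset (Fin m))}
    {I J : Finset (Fin m)} (h : IsBierFace m K I J) : I.card + J.card ≤ m - 1 := by
  obtain ⟨hd, hI, hJ⟩ := h
  have hss : I ⊂ univ \ J :=
    (subset_sdiff.2 ⟨subset_univ I, hd⟩).ssubset_of_ne fun h => hJ (h ▸ hI)
  have hlt := card_lt_card hss
  rw [card_univ_sdiff, Fintype.card_fin] at hlt
  omega

theorem IsBierFace.exists_superface {m : ℕ} {K : Finset (Finset (Fin m))}
    {I J : Finset (Fin m)} (h : IsBierFace m K I J) :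
    ∃ I' J' : Finset (Fin m), IsBierFace m K I' J' ∧ I ⊆ I' ∧ J ⊆ J' ∧
      I'.card + J'.card = m - 1 := by
  obtain ⟨hd, hI, hJ⟩ := h
  have hIJ : I ⊆ univ \ J := subset_sdiff.2 ⟨subset_univ I, hd⟩
  obtain ⟨I', hII', hmax⟩ := (K.filter (· ⊆ univ \ J)).exists_le_maximal
    (mem_filter.2 ⟨hI, hIJ⟩)
  obtain ⟨hI'K, hI'J⟩ := mem_filter.1 hmax.prop
  obtain ⟨v, hvJ, hvI'⟩ := exists_of_ssubset (hI'J.ssubset_of_ne fun h => hJ (h ▸ hI'K))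
  have hins : insert v I' ⊆ univ \ J := insert_subset hvJ hI'J
  have hinsK : insert v I' ∉ K := fun hK =>
    hvI' (hmax.le_of_ge (mem_filter.2 ⟨hK, hins⟩) (subset_insert v I') (mem_insert_self v I'))
  refine ⟨I', univ \ insert v I', ⟨?_, hI'K, ?_⟩, hII', ?_, ?_⟩
  · exact disjoint_sdiff.mono_left (subset_insert v I')
  · rwa [Finset.sdiff_sdiff_eq_self (subset_univ _)]
  · exact subset_sdiff.2 ⟨subset_univ J, (subset_sdiff.1 hins).2.symm⟩
  · have hle := card_le_univ (insert v I')
    rw [card_insert_of_notMem hvI', Fintype.card_fin] at hle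
    rw [card_univ_sdiff, card_insert_of_notMem hvI', Fintype.card_fin]
    omega

/-- `Bier(K)` is pure of dimension `m - 2`: every face `(I, J)` satisfies
`|I| + |J| ≤ m - 1` and is contained (componentwise) in a face of cardinality `m - 1`;
in particular every maximal face has exactly `m - 1` elements. -/
theorem bier_sphere_pure (m : ℕ) (hm : 2 ≤ m) (K : Finset (Finset (Fin m)))
    (hK : IsSimplicialComplex m K) (hKne : K ≠ (Finset.univ : Finset (Fin m)).powerset) :
    (∀ I J : Finset (Fin m), IsBierFace m K I J → I.card + J.card ≤ m - 1) ∧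
    (∀ I J : Finset (Fin m), IsBierFace m K I J →
      ∃ I' J' : Finset (Fin m), IsBierFace m K I' J' ∧ I ⊆ I' ∧ J ⊆ J' ∧
        I'.card + J'.card = m - 1) ∧
    (∀ I J : Finset (Fin m), IsBierFace m K I J →
      (∀ I' J' : Finset (Fin m), IsBierFace m K I' J' → I ⊆ I' → J ⊆ J' →
        I = I' ∧ J = J') →
      I.card + J.card = m - 1) := by
  refine ⟨fun I J h => h.card_add_card_le, fun I J h => h.exists_superface, fun I J h hmax => ?_⟩
  obtain ⟨I', J', h', hI, hJ, hcard⟩ := h.exists_superface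
  obtain ⟨rfl, rfl⟩ := hmax I' J' h' hI hJ
  exact hcard
end

section
/- Let K be a simplicial complex on [m] and let A ⊆ [m] be a minimal non-face of K (A ∉ K and every proper subset of A belongs to K), and set L := K ∪ {A}, which is again a simplicial complex. Then the faces of Bier(L) are obtained from the faces of Bier(K) by removing all pairs (I, [m]∖A) with I ⊊ A and adding all pairs (A, J) with J ⊊ [m]∖A; that is, the set of faces of Bier(L) equals (Faces(Bier(K)) ∖ {(I, [m]∖A) : I ⊊ A, I ∈ K}) ∪ {(A, J) : J ⊊ [m]∖A}. -/
open Finset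

/-- If `A` is a minimal non-face of `K` and `L = K ∪ {A}`, then the faces of `Bier(L)`
are obtained from those of `Bier(K)` by removing the pairs `(I, [m] \ A)` with `I ⊊ A`
and adding the pairs `(A, J)` with `J ⊊ [m] \ A`. -/
theorem bier_faces_add_minimal_nonface (m : ℕ) (hm : 2 ≤ m)
    (K : Finset (Finset (Fin m))) (hK : IsSimplicialComplex m K)
    (A : Finset (Fin m)) (hA : A ∉ K) (hAmin : ∀ B ⊂ A, B ∈ K)
    (L : Finset (Finset (Fin m))) (hL : L = insert A K) :
    {p : Finset (Fin m) × Finset (Fin m) | IsBierFace m L p.1 p.2} =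
      ({p : Finset (Fin m) × Finset (Fin m) | IsBierFace m K p.1 p.2} \
        {p : Finset (Fin m) × Finset (Fin m) |
          p.1 ⊂ A ∧ p.1 ∈ K ∧ p.2 = Finset.univ \ A}) ∪
      {p : Finset (Fin m) × Finset (Fin m) |
        p.1 = A ∧ p.2 ⊂ Finset.univ \ A} := by
  ext ⟨I, J⟩
  have hdisj : Disjoint I J ↔ I ⊆ univ \ J := by
    simp [subset_sdiff]
  have heq : J = univ \ A ↔ univ \ J = A := by
    simp only [← compl_eq_univ_sdiff]
    exact eq_compl_comm.trans eq_comm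
  have hssub : J ⊂ univ \ A ↔ A ⊂ univ \ J := by
    simp only [← compl_eq_univ_sdiff]
    rw [← compl_ssubset_compl, compl_compl]
  simp only [Set.mem_ofPred_eq, Set.mem_union, Set.mem_sdiff, IsBierFace, hL, mem_insert,
    hdisj, heq, hssub, not_or]
  generalize univ \ J = C
  constructor
  · rintro ⟨hIC, rfl | hI, hCA, hC⟩
    · exact Or.inr ⟨rfl, hIC.ssubset_of_ne (Ne.symm hCA)⟩
    · exact Or.inl ⟨⟨hIC, hI, hC⟩, fun h => hCA h.2.2⟩
  · rintro (⟨⟨hIC, hI, hC⟩, hrem⟩ | ⟨rfl, hIC⟩)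
    · refine ⟨hIC, Or.inr hI, ?_, hC⟩
      rintro rfl
      exact hrem ⟨hIC.ssubset_of_ne (fun h => hA (h ▸ hI)), hI, rfl⟩
    · exact ⟨hIC.subset, Or.inl rfl, hIC.ne', fun hC => hA (hK.2 C hC I hIC.subset)⟩
end

section
/- Let m ≥ 2, let K ≠ Δ_{[m]} be a simplicial complex on [m], and set n := m − 1. For −1 ≤ j ≤ n − 1 let f_j denote the number of faces (I,J) of Bier(K) with |I| + |J| = j + 1 (so f_{−1} = 1), and define integers h_0, h_1, …, h_n by the polynomial identity Σ_{i=0}^{n} h_i t^{n−i} = Σ_{j=−1}^{n−1} f_j (t−1)^{n−1−j} in ℤ[t]. Then the Dehn–Sommerville relations h_i = h_{n−i} hold for all 0 ≤ i ≤ n. -/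
open Finset

instance (m : ℕ) (K : Finset (Finset (Fin m))) (I J : Finset (Fin m)) :
    Decidable (IsBierFace m K I J) := by
  unfold IsBierFace; infer_instance

/-- `bierFaceCount m K k` is the number of faces `(I, J)` of `Bier(K)` with
`|I| + |J| = k`; for `k = j + 1` this is the `f`-vector entry `f_j` of `Bier(K)`
(and `bierFaceCount m K 0 = 1 = f_{-1}`). -/
def bierFaceCount (m : ℕ) (K : Finset (Finset (Fin m))) (k : ℕ) : ℕ :=
  (Finset.univ.filter (fun p : Finset (Fin m) × Finset (Fin m) =>
    IsBierFace m K p.1 p.2 ∧ p.1.card + p.2.card = k)).card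

open Polynomial in
/-- The sum over all supersets of `I` of `X - 1` to the relative codimension. -/
theorem sum_superset_X_sub_one_pow {m : ℕ} (I : Finset (Fin m)) :
    ∑ L with I ⊆ L, ((X : ℤ[X]) - 1) ^ (#L - #I) = X ^ (m - #I) := by
  have h := Finset.sum_pow_mul_eq_add_pow ((X : ℤ[X]) - 1) 1 Iᶜ
  simp only [one_pow, mul_one, sub_add_cancel, card_compl, Fintype.card_fin] at h
  rw [← h]
  refine Finset.sum_bij' (fun L _ => L \ I) (fun S _ => S ∪ I) ?_ ?_ ?_ ?_ ?_
  · intro L _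
    simp only [mem_powerset]
    exact fun x hx => mem_compl.2 (mem_sdiff.1 hx).2
  · intro S _
    simp
  · intro L hL
    exact sdiff_union_of_subset (mem_filter.1 hL).2
  · intro S hS
    exact union_sdiff_cancel_right (subset_compl_iff_disjoint_right.1 (mem_powerset.1 hS))
  · intro L hL
    rw [card_sdiff_of_subset (mem_filter.1 hL).2]

open Polynomial in
theorem sum_subset_X_sub_one_pow {α : Type*} (L : Finset α) :
    ∑ I ∈ L.powerset, ((X : ℤ[X]) - 1) ^ (#L - #I) = X ^ #L := by
  have h := Finset.sum_pow_mul_eq_add_pow 1 ((X : ℤ[X]) - 1) L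
  simpa using h

open Polynomial in
/-- Pairs `I ⊆ L` with `I` inside and `L` outside a simplicial complex, weighted by `X - 1` to
the length of the interval. -/
theorem sum_face_nonface_X_sub_one_pow {m : ℕ} {K : Finset (Finset (Fin m))}
    (hK : ∀ s ∈ K, ∀ t ⊆ s, t ∈ K) :
    ∑ I ∈ K, ∑ L with I ⊆ L ∧ L ∉ K, ((X : ℤ[X]) - 1) ^ (#L - #I) =
      ∑ I ∈ K, (X ^ (m - #I) - X ^ #I) := by
  have hswap : ∑ I ∈ K, (X : ℤ[X]) ^ #I =
      ∑ I ∈ K, ∑ L with I ⊆ L ∧ L ∈ K, ((X : ℤ[X]) - 1) ^ (#L - #I) := by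
    rw [← sum_congr rfl fun L _ => sum_subset_X_sub_one_pow L]
    refine sum_comm' fun L I => ?_
    simp only [mem_powerset, mem_filter, mem_univ, true_and]
    exact ⟨fun h => ⟨⟨h.2, h.1⟩, hK L h.1 I h.2⟩, fun h => ⟨h.1.2, h.1.1⟩⟩
  rw [sum_sub_distrib, eq_sub_iff_add_eq, hswap, ← sum_add_distrib]
  refine sum_congr rfl fun I _ => ?_
  rw [← sum_superset_X_sub_one_pow, ← sum_filter_not_add_sum_filter {L | I ⊆ L} (· ∈ K),
    filter_filter, filter_filter]

theorem IsBierFace.card_add_card_lt {m : ℕ} {K : Finset (Finset (Fin m))}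
    {I J : Finset (Fin m)} (h : IsBierFace m K I J) : #I + #J < m := by
  obtain ⟨hd, hI, hJ⟩ := h
  by_contra! hlt
  refine hJ ?_
  have hu : I ∪ J = univ := by
    rw [← card_eq_iff_eq_univ, Fintype.card_fin, card_union_of_disjoint hd]
    have := card_le_univ (I ∪ J)
    rw [card_union_of_disjoint hd, Fintype.card_fin] at this
    omega
  rwa [← hu, union_sdiff_cancel_right hd]

open Polynomial in
/-- The `h`-polynomial of a Bier sphere, multiplied by `X - 1`. -/
theorem X_sub_one_mul_sum_bierFaceCount {n : ℕ} {K : Finset (Finset (Fin (n + 1)))}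
    (hK : ∀ s ∈ K, ∀ t ⊆ s, t ∈ K) :
    ((X : ℤ[X]) - 1) * ∑ k ∈ range (n + 1),
        C (bierFaceCount (n + 1) K k : ℤ) * ((X : ℤ[X]) - 1) ^ (n - k) =
      ∑ I ∈ K, (X ^ (n + 1 - #I) - X ^ #I) := by
  rw [← sum_face_nonface_X_sub_one_pow hK, sum_sigma']
  let faces : Finset (Finset (Fin (n + 1)) × Finset (Fin (n + 1))) :=
    {p | IsBierFace (n + 1) K p.1 p.2}
  have hmaps : ∀ p ∈ faces, #p.1 + #p.2 ∈ range (n + 1) := fun p hp =>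
    mem_range.2 (mem_filter.1 hp).2.card_add_card_lt
  have hfiber : ∑ p ∈ faces, ((X : ℤ[X]) - 1) ^ (n + 1 - (#p.1 + #p.2)) =
      ((X : ℤ[X]) - 1) * ∑ k ∈ range (n + 1),
        C (bierFaceCount (n + 1) K k : ℤ) * ((X : ℤ[X]) - 1) ^ (n - k) := by
    rw [← sum_fiberwise_of_maps_to hmaps, mul_sum]
    refine sum_congr rfl fun k hk => ?_
    rw [sum_congr rfl fun p hp => by rw [(mem_filter.1 hp).2], sum_const, filter_filter,
      nsmul_eq_mul, Nat.succ_sub (Nat.le_of_lt_succ (mem_range.1 hk)), pow_succ, bierFaceCount]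
    simp only [map_natCast]
    ring
  rw [← hfiber]
  refine sum_bij' (fun p _ => ⟨p.1, p.2ᶜ⟩) (fun q _ => (q.1, q.2ᶜ)) ?_ ?_ ?_ ?_ ?_
  · intro p hp
    obtain ⟨hd, hI, hJ⟩ := (mem_filter.1 hp).2
    simp only [mem_sigma, mem_filter, mem_univ, true_and]
    exact ⟨hI, subset_compl_iff_disjoint_right.2 hd, by rwa [compl_eq_univ_sdiff]⟩
  · rintro ⟨I, L⟩ hq
    simp only [mem_sigma, mem_filter, mem_univ, true_and] at hq
    refine mem_filter.2 ⟨mem_univ _, ?_, hq.1, ?_⟩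
    · exact subset_compl_iff_disjoint_right.1 (by simpa using hq.2.1)
    · simpa [← compl_eq_univ_sdiff] using hq.2.2
  · intro p _
    simp
  · intro q _
    simp
  · intro p _
    simp only [card_compl, Fintype.card_fin]
    congr 1
    omega

open Polynomial in
theorem reflect_sum_X_pow_sub_X_pow {ι : Type*} (s : Finset ι) (c : ι → ℕ) {m : ℕ}
    (hc : ∀ i ∈ s, c i ≤ m) :
    reflect m (∑ i ∈ s, (X ^ (m - c i) - X ^ c i : ℤ[X])) =
      -∑ i ∈ s, (X ^ (m - c i) - X ^ c i : ℤ[X]) := by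
  induction s using Finset.cons_induction with
  | empty => simp
  | cons a s ha ih =>
    rw [sum_cons, reflect_add, ih fun i hi => hc i (mem_cons_of_mem hi), reflect_sub, neg_add,
      neg_sub, reflect_monomial, reflect_monomial, revAt_le (Nat.sub_le _ _),
      revAt_le (hc a (mem_cons_self a s)), Nat.sub_sub_self (hc a (mem_cons_self a s))]

open Polynomial in
theorem reflect_eq_self_of_X_sub_one_mul {p : ℤ[X]} {n : ℕ} (hp : p.natDegree ≤ n)
    (h : reflect (n + 1) ((X - 1) * p) = -((X - 1) * p)) : reflect n p = p := by
  have hX : reflect 1 (X - 1 : ℤ[X]) = -(X - 1) := by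
    rw [reflect_sub, reflect_one, ← pow_one (X : ℤ[X]), reflect_monomial, revAt_le le_rfl]
    simp
  have hdeg : (X - 1 : ℤ[X]).natDegree ≤ 1 := by
    simpa using natDegree_X_sub_C_le (1 : ℤ)
  rw [add_comm, reflect_mul _ _ hdeg hp, hX, neg_mul, neg_inj] at h
  exact mul_left_cancel₀ (by simpa using X_sub_C_ne_zero (1 : ℤ)) h

open Polynomial in
theorem coeff_sum_C_mul_X_pow_sub (h : ℕ → ℤ) {n i : ℕ} (hi : i ≤ n) :
    (∑ j ∈ range (n + 1), C (h j) * (X : ℤ[X]) ^ (n - j)).coeff (n - i) = h i := by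
  rw [finsetSum_coeff, sum_eq_single i]
  · simp
  · intro j hj hji
    have := mem_range.1 hj
    rw [coeff_C_mul, coeff_X_pow, if_neg (by omega), mul_zero]
  · intro hni
    exact absurd (mem_range.2 (by omega)) hni

open Polynomial in
/-- Dehn–Sommerville relations for Bier spheres: if `n = m - 1` and the integers
`h_0, ..., h_n` are determined by
`∑_{i=0}^n h_i t^{n-i} = ∑_{j=-1}^{n-1} f_j (t-1)^{n-1-j}` (reindexed by cardinality
`k = j + 1`), then `h_i = h_{n-i}` for all `0 ≤ i ≤ n`. -/
theorem bier_dehn_sommerville (m : ℕ) (hm : 2 ≤ m) (K : Finset (Finset (Fin m)))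
    (hK : IsSimplicialComplex m K) (hKne : K ≠ (Finset.univ : Finset (Fin m)).powerset)
    (n : ℕ) (hn : n = m - 1) (h : ℕ → ℤ)
    (hh : ∑ i ∈ Finset.range (n + 1), C (h i) * (X : ℤ[X]) ^ (n - i) =
          ∑ k ∈ Finset.range (n + 1),
            C ((bierFaceCount m K k : ℤ)) * ((X : ℤ[X]) - 1) ^ (n - k)) :
    ∀ i ≤ n, h i = h (n - i) := by
  obtain rfl : m = n + 1 := by omega
  set P : ℤ[X] := ∑ i ∈ Finset.range (n + 1), C (h i) * (X : ℤ[X]) ^ (n - i) with hP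
  have hdeg : P.natDegree ≤ n := natDegree_sum_le_of_forall_le _ _ fun i _ =>
    (natDegree_C_mul_X_pow_le _ _).trans (Nat.sub_le _ _)
  have hmul : (X - 1) * P = ∑ I ∈ K, (X ^ (n + 1 - #I) - X ^ #I) := by
    rw [hh, X_sub_one_mul_sum_bierFaceCount hK.2]
  have hrefl : reflect n P = P := by
    refine reflect_eq_self_of_X_sub_one_mul hdeg ?_
    rw [hmul, reflect_sum_X_pow_sub_X_pow]
    exact fun I _ => card_finset_fin_le I
  intro i hi
  rw [← coeff_sum_C_mul_X_pow_sub h hi, ← coeff_sum_C_mul_X_pow_sub h (Nat.sub_le n i), ← hP]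
  nth_rewrite 1 [← hrefl]
  rw [coeff_reflect, revAt_le (Nat.sub_le _ _)]
end

section
/- Let K ≠ Δ_{[3]} be a simplicial complex on [3] = {1,2,3}. Let p be the number of faces (I,J) of Bier(K) with |I| + |J| = 2 (the edges) and let q be the number of faces with |I| + |J| = 1 (the geometric vertices). Then p = q and 3 ≤ p ≤ 6; i.e., every 1-dimensional Bier sphere is the boundary of a p-gon with p ∈ {3,4,5,6}. -/
open Finset

lemma filter_disjoint_card_two :
    (univ.filter fun pr : Finset (Fin 3) × Finset (Fin 3) =>
      Disjoint pr.1 pr.2 ∧ pr.1.card + pr.2.card = 2) =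
    {({0, 1}, ∅), ({0, 2}, ∅), ({1, 2}, ∅), (∅, {0, 1}), (∅, {0, 2}), (∅, {1, 2}),
      ({0}, {1}), ({0}, {2}), ({1}, {0}), ({1}, {2}), ({2}, {0}), ({2}, {1})} := by
  decide +kernel

lemma filter_disjoint_card_one :
    (univ.filter fun pr : Finset (Fin 3) × Finset (Fin 3) =>
      Disjoint pr.1 pr.2 ∧ pr.1.card + pr.2.card = 1) =
    {({0}, ∅), ({1}, ∅), ({2}, ∅), (∅, {0}), (∅, {1}), (∅, {2})} := by
  decide +kernel

/-- Every 1-dimensional Bier sphere is the boundary of a `p`-gon with `p ∈ {3, 4, 5, 6}`: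
for a simplicial complex `K ≠ Δ_{[3]}` on `[3]`, the number `p` of edges of `Bier(K)`
equals the number `q` of its geometric vertices and `3 ≤ p ≤ 6`. -/
theorem bier_sphere_dim_one (K : Finset (Finset (Fin 3)))
    (hK : IsSimplicialComplex 3 K) (hKne : K ≠ (Finset.univ : Finset (Fin 3)).powerset)
    (p q : ℕ)
    (hp : p = (Finset.univ.filter (fun pr : Finset (Fin 3) × Finset (Fin 3) =>
      IsBierFace 3 K pr.1 pr.2 ∧ pr.1.card + pr.2.card = 2)).card)
    (hq : q = (Finset.univ.filter (fun pr : Finset (Fin 3) × Finset (Fin 3) =>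
      IsBierFace 3 K pr.1 pr.2 ∧ pr.1.card + pr.2.card = 1)).card) :
    p = q ∧ 3 ≤ p ∧ p ≤ 6 := by
  have key (n : ℕ) : (univ.filter fun pr : Finset (Fin 3) × Finset (Fin 3) =>
      IsBierFace 3 K pr.1 pr.2 ∧ pr.1.card + pr.2.card = n).card =
      ∑ pr ∈ univ.filter (fun pr : Finset (Fin 3) × Finset (Fin 3) =>
        Disjoint pr.1 pr.2 ∧ pr.1.card + pr.2.card = n),
        if pr.1 ∈ K ∧ univ \ pr.2 ∉ K then 1 else 0 := by
    rw [← card_filter, filter_filter]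
    congr 1
    ext pr
    rw [mem_filter, mem_filter, IsBierFace]
    tauto
  obtain ⟨⟨s, hs⟩, hdown⟩ := hK
  have h_empty : ∅ ∈ K := hdown s hs ∅ (empty_subset s)
  have h_univ : univ ∉ K := fun h => hKne <| by
    ext t
    simpa using hdown univ h t (subset_univ t)
  have h01 : ({0, 1} : Finset (Fin 3)) ∈ K → {0} ∈ K ∧ {1} ∈ K :=
    fun h => ⟨hdown _ h _ (by decide), hdown _ h _ (by decide)⟩
  have h02 : ({0, 2} : Finset (Fin 3)) ∈ K → {0} ∈ K ∧ {2} ∈ K :=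
    fun h => ⟨hdown _ h _ (by decide), hdown _ h _ (by decide)⟩
  have h12 : ({1, 2} : Finset (Fin 3)) ∈ K → {1} ∈ K ∧ {2} ∈ K :=
    fun h => ⟨hdown _ h _ (by decide), hdown _ h _ (by decide)⟩
  have d0 : (univ \ {0} : Finset (Fin 3)) = {1, 2} := by decide
  have d1 : (univ \ {1} : Finset (Fin 3)) = {0, 2} := by decide
  have d2 : (univ \ {2} : Finset (Fin 3)) = {0, 1} := by decide
  have d01 : (univ \ {0, 1} : Finset (Fin 3)) = {2} := by decide
  have d02 : (univ \ {0, 2} : Finset (Fin 3)) = {1} := by decide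
  have d12 : (univ \ {1, 2} : Finset (Fin 3)) = {0} := by decide
  rw [key, filter_disjoint_card_two] at hp
  rw [key, filter_disjoint_card_one] at hq
  repeat rw [sum_insert (by decide)] at hp
  repeat rw [sum_insert (by decide)] at hq
  simp only [sum_singleton, sdiff_empty, d0, d1, d2, d01, d02, d12, h_empty, h_univ,
    true_and, not_false_eq_true, and_true] at hp hq
  clear key hdown hKne d0 d1 d2 d01 d02 d12
  by_cases a : ({0} : Finset (Fin 3)) ∈ K <;> by_cases b : ({1} : Finset (Fin 3)) ∈ K <;>
    by_cases c : ({2} : Finset (Fin 3)) ∈ K <;>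
    by_cases ab : ({0, 1} : Finset (Fin 3)) ∈ K <;>
    by_cases ac : ({0, 2} : Finset (Fin 3)) ∈ K <;>
    by_cases bc : ({1, 2} : Finset (Fin 3)) ∈ K <;>
    simp_all
end

section
/- Let m ≥ 2 and let I, J ⊆ [m] be disjoint subsets with I ∪ J ≠ [m]. Then for any subsets I′ ⊆ I and J′ ⊆ J, the cone C(I′,J′) is an extreme subset (a face) of the convex cone C(I,J): C(I′,J′) ⊆ C(I,J), and whenever a point of C(I′,J′) lies in the open segment between two points of C(I,J), both endpoints of that segment belong to C(I′,J′). -/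
open Finset

theorem mem_coneC_iff {m : ℕ} {I J : Finset (Fin m)} (hIJ : Disjoint I J)
    {x : Fin (m - 1) → ℝ} :
    x ∈ coneC m I J ↔ ∃ c : Fin m → ℝ, (∀ i ∈ I, c i ≤ 0) ∧ (∀ j ∈ J, 0 ≤ c j) ∧
      (∀ i ∉ I ∪ J, c i = 0) ∧ x = ∑ i, c i • bierVec m i := by
  rw [Finset.disjoint_left] at hIJ
  constructor
  · rintro ⟨a, b, ha, hb, rfl⟩
    refine ⟨fun i => (if i ∈ J then b i else 0) - (if i ∈ I then a i else 0),
      fun i hi => ?_, fun j hj => ?_, fun i hi => ?_, ?_⟩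
    · simp [hi, hIJ hi, ha i]
    · have hjI : j ∉ I := fun h => hIJ h hj
      simp [hj, hjI, hb j]
    · rw [Finset.mem_union, not_or] at hi
      simp [hi.1, hi.2]
    · simp [sub_smul, ite_smul, Finset.sum_sub_distrib, Finset.sum_ite_mem]
      abel
  · rintro ⟨c, hI, hJ, h0, rfl⟩
    refine ⟨fun i => |c i|, fun i => |c i|, fun i => abs_nonneg _, fun i => abs_nonneg _, ?_⟩
    rw [← Finset.sum_subset (Finset.subset_univ (I ∪ J)) fun i _ hi => by rw [h0 i hi, zero_smul],
      Finset.sum_union (Finset.disjoint_left.mpr hIJ)]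
    congr 1
    · refine Finset.sum_congr rfl fun i hi => ?_
      simp only [abs_of_nonpos (hI i hi), neg_smul_neg]
    · refine Finset.sum_congr rfl fun i hi => ?_
      simp only [abs_of_nonneg (hJ i hi)]

/-- Any linear relation among the vectors `bierVec m i` has constant coefficients. -/
theorem eq_of_sum_smul_bierVec_eq_zero {m : ℕ} {d : Fin m → ℝ}
    (h : ∑ i, d i • bierVec m i = 0) (i j : Fin m) : d i = d j := by
  obtain _ | n := m
  · exact i.elim0
  have key : ∀ k : Fin n, d k.castSucc = d (Fin.last n) := fun k => by
    have hk := congrFun h k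
    have hcast (l : Fin n) : bierVec (n + 1) l.castSucc = Pi.single l 1 := by
      simp [bierVec]
    have hlast : bierVec (n + 1) (Fin.last n) = fun _ => -1 := by
      simp [bierVec]
    simp only [Fin.sum_univ_castSucc, hcast, hlast] at hk
    have hsum : (∑ l : Fin n, d l.castSucc • (Pi.single l 1 : Fin n → ℝ)) k = d k.castSucc := by
      simp [Finset.sum_apply, Pi.single_apply]
    change (∑ l : Fin n, d l.castSucc • (Pi.single l 1 : Fin n → ℝ)) k + d (Fin.last n) * -1 = 0
      at hk
    linarith
  have key' (k : Fin (n + 1)) : d k = d (Fin.last n) := by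
    induction k using Fin.lastCases with
    | last => rfl
    | cast k => exact key k
  rw [key' i, key' j]

/-- For disjoint `I, J ⊆ [m]` with `I ∪ J ≠ [m]` and any `I' ⊆ I`, `J' ⊆ J`, the cone
`C(I', J')` is an extreme subset (a face) of the convex cone `C(I, J)`. -/
theorem bier_cone_face_isExtreme (m : ℕ) (hm : 2 ≤ m) (I J : Finset (Fin m))
    (hIJ : Disjoint I J) (hne : I ∪ J ≠ Finset.univ)
    (I' J' : Finset (Fin m)) (hI' : I' ⊆ I) (hJ' : J' ⊆ J) :
    IsExtreme ℝ (coneC m I J) (coneC m I' J') := by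
  have hIJ' : Disjoint I' J' := hIJ.mono hI' hJ'
  have hU : I' ∪ J' ⊆ I ∪ J := Finset.union_subset_union hI' hJ'
  obtain ⟨k, hk⟩ : ∃ k, k ∉ I ∪ J := by
    simpa [Finset.eq_univ_iff_forall] using hne
  refine ⟨fun x hx => ?_, fun x hx y hy z hz hxyz => ?_⟩
  · obtain ⟨a, b, ha, hb, rfl⟩ := hx
    refine ⟨fun i => if i ∈ I' then a i else 0, fun j => if j ∈ J' then b j else 0,
      fun i => ?_, fun j => ?_, ?_⟩
    · dsimp only
      split_ifs <;> simp [ha]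
    · dsimp only
      split_ifs <;> simp [hb]
    · simp only [ite_smul, zero_smul, Finset.sum_ite_mem, Finset.inter_eq_right.mpr hI',
        Finset.inter_eq_right.mpr hJ']
  · rw [mem_coneC_iff hIJ] at hx hy
    rw [mem_coneC_iff hIJ'] at hz ⊢
    obtain ⟨c, hcI, hcJ, hc, rfl⟩ := hx
    obtain ⟨d, hdI, hdJ, hd, rfl⟩ := hy
    obtain ⟨e, -, -, he, rfl⟩ := hz
    obtain ⟨s, t, hs, ht, -, hst⟩ := hxyz
    have hrel : ∑ i, (s * c i + t * d i - e i) • bierVec m i = 0 := by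
      simp only [sub_smul, add_smul, mul_smul, Finset.sum_sub_distrib, Finset.sum_add_distrib,
        ← Finset.smul_sum, hst, sub_self]
    have hzero (i : Fin m) : s * c i + t * d i - e i = 0 := by
      rw [eq_of_sum_smul_bierVec_eq_zero hrel i k, hc k hk, hd k hk, he k fun h => hk (hU h)]
      simp
    refine ⟨c, fun i hi => hcI i (hI' hi), fun j hj => hcJ j (hJ' hj), fun i hi => ?_, rfl⟩
    have hi0 := hzero i
    rw [he i hi] at hi0
    by_cases hiU : i ∈ I ∪ J
    · rcases Finset.mem_union.mp hiU with h | h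
      · have h1 := hcI i h
        have h2 := mul_nonpos_of_nonneg_of_nonpos ht.le (hdI i h)
        nlinarith
      · have h1 := hcJ i h
        have h2 := mul_nonneg ht.le (hdJ i h)
        nlinarith
    · exact hc i hiU
end
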